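/- arXiv:1506.01339 — 6 statements merged into one kernel-verified Lean document; each statement's English description precedes it below -/
import Mathlib

section
/- Let y_1,…,y_n ∈ {0,1} be ground-truth labels with n0 = #{i : y_i = 0} ≥ 1 and n1 = #{i : y_i = 1} ≥ 1, and let the real-valued guesses ŷ_1,…,ŷ_n be strictly increasing (ŷ_1 < ŷ_2 < … < ŷ_n, i.e., the examples are indexed in the rank order of the guesses). Let c = f(y_{1:n}, ŷ_{1:n}) be the AUC of these guesses. Then for any positive integer k ≤ n0, if c > 1 − 1/n1 + k/(n0·n1), then y_i = 0 for every i ∈ {1,…,k}, i.e., the first k examples in the rank order of the guesses must be negatively labeled. -/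
open Finset

/-- AUC of real-valued guesses `g` against binary labels `y` (`false` = 0, `true` = 1):
`(1/(n0*n1)) * Σ_{i : y i = 0} Σ_{j : y j = 1} 1[g i < g j]`. -/
noncomputable def auc {n : ℕ} (y : Fin n → Bool) (g : Fin n → ℝ) : ℝ :=
  (∑ i ∈ Finset.univ.filter fun i => y i = false,
      ∑ j ∈ Finset.univ.filter fun j => y j = true,
        if g i < g j then (1 : ℝ) else 0) /
    (((Finset.univ.filter fun i : Fin n => y i = false).card : ℝ) *
      ((Finset.univ.filter fun j : Fin n => y j = true).card : ℝ))

/-- If the example at position `m` in the rank order is positive, then every negative example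
ranked after `m` is misordered with respect to it. -/
theorem sum_auc_pairs_le {n : ℕ} (y : Fin n → Bool) (g : Fin n → ℝ) (hg : StrictMono g)
    {m : Fin n} (hm : y m = true) :
    (∑ i ∈ Finset.univ.filter fun i => y i = false,
      ∑ j ∈ Finset.univ.filter fun j => y j = true,
        if g i < g j then (1 : ℝ) else 0) ≤
      ((Finset.univ.filter fun i : Fin n => y i = false).card : ℝ) *
        (((Finset.univ.filter fun j : Fin n => y j = true).card : ℝ) - 1) + (m : ℕ) := by
  have hmem : m ∈ Finset.univ.filter fun j => y j = true := by simp [hm]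
  have inner (i : Fin n) :
      (∑ j ∈ Finset.univ.filter fun j => y j = true, if g i < g j then (1 : ℝ) else 0) ≤
        (((Finset.univ.filter fun j : Fin n => y j = true).card : ℝ) - 1) +
          if i < m then 1 else 0 := by
    rw [← Finset.add_sum_erase _ _ hmem]
    have hrest : (∑ j ∈ (Finset.univ.filter fun j => y j = true).erase m,
        if g i < g j then (1 : ℝ) else 0) ≤
          ((Finset.univ.filter fun j : Fin n => y j = true).card : ℝ) - 1 := by
      rw [Finset.sum_boole, ← Finset.cast_card_erase_of_mem hmem]
      exact_mod_cast Finset.card_filter_le _ _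
    simp only [hg.lt_iff_lt] at hrest ⊢
    linarith
  have hcount : (∑ i ∈ Finset.univ.filter fun i => y i = false,
      if i < m then (1 : ℝ) else 0) ≤ (m : ℕ) := by
    rw [Finset.sum_boole, Nat.cast_le, ← Fin.card_Iio m]
    exact Finset.card_le_card fun i hi => by simpa using (Finset.mem_filter.mp hi).2
  refine (Finset.sum_le_sum fun i _ => inner i).trans ?_
  rw [Finset.sum_add_distrib, Finset.sum_const, nsmul_eq_mul]
  linarith

/-- If the guesses are strictly increasing and the AUC `c` satisfies
`c > 1 - 1/n1 + k/(n0*n1)` for some positive `k ≤ n0`, then the first `k` examples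
must be negatively labeled. -/
theorem stmt0 {n : ℕ} (y : Fin n → Bool) (g : Fin n → ℝ) (hg : StrictMono g)
    (n0 n1 : ℕ)
    (hn0 : n0 = (Finset.univ.filter fun i => y i = false).card)
    (hn1 : n1 = (Finset.univ.filter fun i => y i = true).card)
    (hn0pos : 1 ≤ n0) (hn1pos : 1 ≤ n1)
    (c : ℝ) (hc : c = auc y g)
    (k : ℕ) (hk1 : 1 ≤ k) (hkn0 : k ≤ n0)
    (hgt : c > 1 - 1 / (n1 : ℝ) + (k : ℝ) / ((n0 : ℝ) * (n1 : ℝ))) :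
    ∀ i : Fin n, (i : ℕ) < k → y i = false := by
  intro m hm
  by_contra hy
  have hym : y m = true := by simpa using hy
  have hn0' : (0 : ℝ) < n0 := by exact_mod_cast hn0pos
  have hn1' : (0 : ℝ) < n1 := by exact_mod_cast hn1pos
  have hS := sum_auc_pairs_le y g hg hym
  rw [hc, auc, ← hn0, ← hn1] at hgt
  rw [← hn0, ← hn1] at hS
  have hrw : 1 - 1 / (n1 : ℝ) + (k : ℝ) / ((n0 : ℝ) * (n1 : ℝ)) =
      ((n0 : ℝ) * (n1 - 1) + k) / ((n0 : ℝ) * (n1 : ℝ)) := by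
    field_simp
  rw [hrw, gt_iff_lt, div_lt_div_iff_of_pos_right (mul_pos hn0' hn1')] at hgt
  have hmk : ((m : ℕ) : ℝ) < k := by exact_mod_cast hm
  linarith
end

section
/- Let y_1,…,y_n ∈ {0,1} be ground-truth labels with n0 = #{i : y_i = 0} ≥ 1 and n1 = #{i : y_i = 1} ≥ 1, and let the real-valued guesses ŷ_1,…,ŷ_n be strictly increasing (ŷ_1 < ŷ_2 < … < ŷ_n, i.e., the examples are indexed in the rank order of the guesses). Let c = f(y_{1:n}, ŷ_{1:n}) be the AUC of these guesses. Then for any positive integer k ≤ n1, if c > 1 − 1/n0 + k/(n0·n1), then y_i = 1 for every i ∈ {n−k+1,…,n}, i.e., the last k examples in the rank order of the guesses must be positively labeled. -/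
open Finset

/-- If a negative example has fewer than `k` examples ranked above it, the number of correctly
ordered pairs is less than `(n0 - 1) * n1 + k`. -/
theorem sum_correctly_ordered_pairs_lt {n : ℕ} (y : Fin n → Bool) (g : Fin n → ℝ)
    (hg : StrictMono g) (k : ℕ) (i : Fin n) (hi : n - k ≤ (i : ℕ))
    (hy : y i = false) :
    (∑ a ∈ Finset.univ.filter fun a => y a = false,
      ∑ b ∈ Finset.univ.filter fun b => y b = true, if g a < g b then (1 : ℝ) else 0) <
    (((Finset.univ.filter fun a => y a = false).card : ℝ) - 1) *
      ((Finset.univ.filter fun b => y b = true).card : ℝ) + k := by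
  have hmem : i ∈ Finset.univ.filter fun a => y a = false := by simp [hy]
  rw [← Finset.sum_erase_add _ _ hmem]
  have hrest : ∑ a ∈ (Finset.univ.filter fun a => y a = false).erase i,
      (∑ b ∈ Finset.univ.filter fun b => y b = true, if g a < g b then (1 : ℝ) else 0) ≤
      (((Finset.univ.filter fun a => y a = false).card : ℝ) - 1) *
        ((Finset.univ.filter fun b => y b = true).card : ℝ) := by
    refine (Finset.sum_le_card_nsmul _ _
      ((Finset.univ.filter fun b => y b = true).card : ℝ) fun a _ => ?_).trans_eq ?_
    · rw [Finset.sum_boole]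
      exact_mod_cast Finset.card_filter_le _ _
    · rw [nsmul_eq_mul, Finset.card_erase_of_mem hmem,
        Nat.cast_pred (Finset.card_pos.mpr ⟨i, hmem⟩)]
  have habove : (∑ b ∈ Finset.univ.filter fun b => y b = true,
      if g i < g b then (1 : ℝ) else 0) < k := by
    rw [Finset.sum_boole]
    have hsub : (Finset.univ.filter fun b => y b = true).filter (fun b => g i < g b) ⊆
        Finset.Ioi i := fun b hb => by
      simpa [hg.lt_iff_lt] using (Finset.mem_filter.mp hb).2
    have hcard := Finset.card_le_card hsub
    rw [Fin.card_Ioi] at hcard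
    exact_mod_cast (show _ < k by have := i.isLt; omega)
  linarith

/-- If the guesses are strictly increasing and the AUC `c` satisfies
`c > 1 - 1/n0 + k/(n0*n1)` for some positive `k ≤ n1`, then the last `k` examples
must be positively labeled. -/
theorem stmt1 {n : ℕ} (y : Fin n → Bool) (g : Fin n → ℝ) (hg : StrictMono g)
    (n0 n1 : ℕ)
    (hn0 : n0 = (Finset.univ.filter fun i => y i = false).card)
    (hn1 : n1 = (Finset.univ.filter fun i => y i = true).card)
    (hn0pos : 1 ≤ n0) (hn1pos : 1 ≤ n1)
    (c : ℝ) (hc : c = auc y g)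
    (k : ℕ) (hk1 : 1 ≤ k) (hkn1 : k ≤ n1)
    (hgt : c > 1 - 1 / (n0 : ℝ) + (k : ℝ) / ((n0 : ℝ) * (n1 : ℝ))) :
    ∀ i : Fin n, n - k ≤ (i : ℕ) → y i = true := by
  intro i hi
  by_contra hy
  have hlt := sum_correctly_ordered_pairs_lt y g hg k i hi (by simpa using hy)
  rw [hc, auc, ← hn0, ← hn1] at hgt
  rw [← hn0, ← hn1] at hlt
  have h0 : (0 : ℝ) < n0 := by exact_mod_cast hn0pos
  have h1 : (0 : ℝ) < n1 := by exact_mod_cast hn1pos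
  have hbound : 1 - 1 / (n0 : ℝ) + (k : ℝ) / ((n0 : ℝ) * (n1 : ℝ)) =
      (((n0 : ℝ) - 1) * n1 + k) / ((n0 : ℝ) * n1) := by
    field_simp
  rw [hbound] at hgt
  exact lt_asymm hgt (div_lt_div_of_pos_right hlt (mul_pos h0 h1))
end

section
/- Let y_1,…,y_n ∈ {0,1} be ground-truth labels with n0 = #{i : y_i = 0} ≥ 1 and n1 = #{i : y_i = 1} ≥ 1, and let the real-valued guesses ŷ_1,…,ŷ_n be strictly increasing (ŷ_1 < ŷ_2 < … < ŷ_n). Let k ≤ n0 be a positive integer, and suppose exactly m of the first k examples are positively labeled (m = #{i ≤ k : y_i = 1}) with m ≥ 1. Then at least m·(n0 − k) of the n0·n1 positive–negative pairs are misclassified by the guesses (i.e., there exist at least m·(n0 − k) pairs (i, j) with y_i = 1, y_j = 0, and ŷ_i < ŷ_j), and consequently the AUC satisfies f(y_{1:n}, ŷ_{1:n}) ≤ 1 − m·(n0 − k)/(n0·n1) ≤ 1 − 1/n1 + k/(n0·n1). -/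
open Finset

/-- With injective guesses, every negative–positive pair is either correctly ranked or
misclassified. -/
theorem auc_eq_one_sub_misclassified {n : ℕ} (y : Fin n → Bool) (g : Fin n → ℝ)
    (hg : Function.Injective g)
    (h0 : 0 < (Finset.univ.filter fun i => y i = false).card)
    (h1 : 0 < (Finset.univ.filter fun i => y i = true).card) :
    auc y g = 1 - ((Finset.univ.filter fun p : Fin n × Fin n =>
          y p.1 = true ∧ y p.2 = false ∧ g p.1 < g p.2).card : ℝ) /
      (((Finset.univ.filter fun i => y i = false).card : ℝ) *
        ((Finset.univ.filter fun i => y i = true).card : ℝ)) := by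
  have hmis : ((Finset.univ.filter fun p : Fin n × Fin n =>
      y p.1 = true ∧ y p.2 = false ∧ g p.1 < g p.2).card : ℝ) =
      ∑ i ∈ Finset.univ.filter fun i => y i = false,
        ∑ j ∈ Finset.univ.filter fun j => y j = true, if g j < g i then (1 : ℝ) else 0 := by
    rw [Finset.card_filter, Nat.cast_sum, Fintype.sum_prod_type_right, Finset.sum_filter]
    refine Finset.sum_congr rfl fun i _ => ?_
    rw [Finset.sum_filter]
    by_cases hi : y i = false
    · rw [if_pos hi]
      refine Finset.sum_congr rfl fun j _ => ?_
      by_cases hj : y j = true <;> simp [hi, hj]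
    · simp [hi]
  have hpair : ∀ i ∈ Finset.univ.filter (fun i => y i = false),
      ∀ j ∈ Finset.univ.filter (fun j => y j = true),
        (if g i < g j then (1 : ℝ) else 0) = 1 - if g j < g i then (1 : ℝ) else 0 := by
    intro i hi j hj
    have hne : g i ≠ g j := fun h => by
      have := hg h
      simp_all
    rcases hne.lt_or_gt with h | h <;> simp [h, h.not_gt]
  have h0' : ((Finset.univ.filter fun i => y i = false).card : ℝ) ≠ 0 := by positivity
  have h1' : ((Finset.univ.filter fun i => y i = true).card : ℝ) ≠ 0 := by positivity
  rw [auc, hmis, Finset.sum_congr rfl fun i hi => Finset.sum_congr rfl (hpair i hi)]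
  simp only [Finset.sum_sub_distrib, Finset.sum_const, nsmul_eq_mul, mul_one]
  rw [sub_div, div_self (mul_ne_zero h0' h1')]

/-- Each positive example among the first `k` is misclassified against each negative example
after them. -/
theorem mul_sub_le_card_misclassified {n : ℕ} (y : Fin n → Bool) (g : Fin n → ℝ)
    (hg : StrictMono g) (k : ℕ) :
    (Finset.univ.filter fun i : Fin n => (i : ℕ) < k ∧ y i = true).card *
        ((Finset.univ.filter fun i => y i = false).card - k) ≤
      (Finset.univ.filter fun p : Fin n × Fin n =>
          y p.1 = true ∧ y p.2 = false ∧ g p.1 < g p.2).card := by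
  have hfirst : (Finset.univ.filter fun i : Fin n => (i : ℕ) < k).card ≤ k := by
    simpa using Finset.card_le_card_of_injOn (t := Finset.range k) (fun i : Fin n => (i : ℕ))
      (fun i hi => by simpa using hi) Fin.val_injective.injOn
  have hlast : (Finset.univ.filter fun i => y i = false).card - k ≤
      ((Finset.univ.filter fun i => y i = false) \
        Finset.univ.filter fun i : Fin n => (i : ℕ) < k).card :=
    (Nat.sub_le_sub_left hfirst _).trans (Finset.le_card_sdiff _ _)
  refine (Nat.mul_le_mul_left _ hlast).trans ?_
  rw [← Finset.card_product]
  refine Finset.card_le_card fun p hp => ?_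
  simp only [Finset.mem_product, Finset.mem_sdiff, Finset.mem_filter, Finset.mem_univ,
    true_and, not_lt] at hp ⊢
  exact ⟨hp.1.2, hp.2.1, hg (Fin.lt_def.2 (hp.1.1.trans_le hp.2.2))⟩

/-- If exactly `m ≥ 1` of the first `k ≤ n0` examples (in the rank order of strictly
increasing guesses) are positively labeled, then at least `m*(n0-k)` positive–negative
pairs are misclassified, and hence
`AUC ≤ 1 - m*(n0-k)/(n0*n1) ≤ 1 - 1/n1 + k/(n0*n1)`. -/
theorem stmt2 {n : ℕ} (y : Fin n → Bool) (g : Fin n → ℝ) (hg : StrictMono g)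
    (n0 n1 : ℕ)
    (hn0 : n0 = (Finset.univ.filter fun i => y i = false).card)
    (hn1 : n1 = (Finset.univ.filter fun i => y i = true).card)
    (hn0pos : 1 ≤ n0) (hn1pos : 1 ≤ n1)
    (k : ℕ) (hk1 : 1 ≤ k) (hkn0 : k ≤ n0)
    (m : ℕ)
    (hm : m = (Finset.univ.filter fun i : Fin n => (i : ℕ) < k ∧ y i = true).card)
    (hm1 : 1 ≤ m) :
    m * (n0 - k) ≤
      (Finset.univ.filter fun p : Fin n × Fin n =>
          y p.1 = true ∧ y p.2 = false ∧ g p.1 < g p.2).card ∧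
    auc y g ≤ 1 - ((m : ℝ) * ((n0 : ℝ) - (k : ℝ))) / ((n0 : ℝ) * (n1 : ℝ)) ∧
    auc y g ≤ 1 - 1 / (n1 : ℝ) + (k : ℝ) / ((n0 : ℝ) * (n1 : ℝ)) := by
  have hmis := mul_sub_le_card_misclassified y g hg k
  have hauc := auc_eq_one_sub_misclassified y g hg.injective (hn0 ▸ hn0pos) (hn1 ▸ hn1pos)
  rw [← hm, ← hn0] at hmis
  rw [← hn0, ← hn1] at hauc
  have h0 : (0 : ℝ) < n0 := by exact_mod_cast hn0pos
  have h1 : (0 : ℝ) < n1 := by exact_mod_cast hn1pos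
  have hm1' : (1 : ℝ) ≤ m := by exact_mod_cast hm1
  have hk : (0 : ℝ) ≤ (n0 : ℝ) - k := sub_nonneg.2 (by exact_mod_cast hkn0)
  have hbound : auc y g ≤ 1 - ((m : ℝ) * ((n0 : ℝ) - (k : ℝ))) / ((n0 : ℝ) * (n1 : ℝ)) := by
    rw [hauc]
    gcongr
    rw [← Nat.cast_sub hkn0]
    exact_mod_cast hmis
  refine ⟨hmis, hbound, hbound.trans ?_⟩
  calc 1 - ((m : ℝ) * ((n0 : ℝ) - (k : ℝ))) / ((n0 : ℝ) * (n1 : ℝ))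
      ≤ 1 - ((n0 : ℝ) - (k : ℝ)) / ((n0 : ℝ) * (n1 : ℝ)) := by
        gcongr
        exact le_mul_of_one_le_left hk hm1'
    _ = 1 - 1 / (n1 : ℝ) + (k : ℝ) / ((n0 : ℝ) * (n1 : ℝ)) := by
        field_simp
        ring
end

section
/- Let q be a positive integer, let n = 4q, and let ŷ_1,…,ŷ_n be any pairwise-distinct real-valued guesses. Then for every rational c = p/q with p a positive integer and p < q (so 0 < c < 1), the number of distinct binary labelings (y_1,…,y_n) ∈ {0,1}^n for which f(y_{1:n}, ŷ_{1:n}) = c is at least (2 − 2·|c − 1/2|)^{n/4} = (2 − 2·|p/q − 1/2|)^q. -/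
open Finset

theorem div_pow_le_choose {n r : ℕ} (h : r ≤ n) :
    ((n : ℝ) / (r : ℝ)) ^ r ≤ (n.choose r : ℝ) := by
  induction r generalizing n with
  | zero => simp
  | succ r ih =>
    obtain ⟨n, rfl⟩ : ∃ m, n = m + 1 := ⟨n - 1, by omega⟩
    have hrn : r ≤ n := by omega
    have hrec : ((n + 1).choose (r + 1) : ℝ) =
        ((n + 1 : ℕ) : ℝ) / ((r + 1 : ℕ) : ℝ) * n.choose r := by
      have := Nat.add_one_mul_choose_eq n r
      rw [div_mul_eq_mul_div, eq_div_iff (by positivity)]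
      exact_mod_cast this.symm
    rw [hrec, pow_succ']
    refine mul_le_mul_of_nonneg_left (le_trans ?_ (ih hrn)) (by positivity)
    rcases Nat.eq_zero_or_pos r with rfl | hr
    · simp
    · refine pow_le_pow_left₀ (by positivity) ?_ r
      rw [div_le_div_iff₀ (by positivity) (by positivity)]
      have : (r : ℝ) ≤ n := by exact_mod_cast hrn
      push_cast
      nlinarith

/-- Reindexing the examples does not change the AUC. -/
theorem auc_comp_equiv {n : ℕ} (e : Fin n ≃ Fin n) (y : Fin n → Bool) (g : Fin n → ℝ) :
    auc (y ∘ e) (g ∘ e) = auc y g := by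
  unfold auc
  simp only [Finset.sum_filter, Finset.card_filter, Function.comp_apply]
  congr 1
  · rw [← Equiv.sum_comp e fun i => if y i = false then
      ∑ j, if y j = true then if g i < g j then (1 : ℝ) else 0 else 0 else 0]
    refine Finset.sum_congr rfl fun i _ => ?_
    split_ifs
    · exact Equiv.sum_comp e fun j => if y j = true then if g (e i) < g j then (1 : ℝ) else 0 else 0
    · rfl
  · rw [Equiv.sum_comp e fun i => if y i = false then 1 else 0,
      Equiv.sum_comp e fun i => if y i = true then 1 else 0]

/-- Reversing the order of the guesses complements the AUC. -/
theorem auc_neg {n : ℕ} (y : Fin n → Bool) (g : Fin n → ℝ) (hg : Function.Injective g)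
    (h0 : ∃ i, y i = false) (h1 : ∃ i, y i = true) :
    auc y (fun i => -g i) = 1 - auc y g := by
  unfold auc
  have c0 : 0 < (Finset.univ.filter fun i : Fin n => y i = false).card := by
    obtain ⟨i, hi⟩ := h0
    exact Finset.card_pos.mpr ⟨i, by simp [hi]⟩
  have c1 : 0 < (Finset.univ.filter fun i : Fin n => y i = true).card := by
    obtain ⟨i, hi⟩ := h1
    exact Finset.card_pos.mpr ⟨i, by simp [hi]⟩
  have hc : ((Finset.univ.filter fun i : Fin n => y i = false).card : ℝ) *
      ((Finset.univ.filter fun j : Fin n => y j = true).card : ℝ) ≠ 0 := by positivity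
  rw [eq_sub_iff_add_eq, ← add_div, div_eq_one_iff_eq hc, ← Finset.sum_add_distrib,
    ← nsmul_eq_mul, ← Finset.sum_const]
  refine Finset.sum_congr rfl fun i hi => ?_
  rw [← Finset.sum_add_distrib, Finset.card_eq_sum_ones, Nat.cast_sum]
  refine Finset.sum_congr rfl fun j hj => ?_
  have hij : g i ≠ g j := fun h => by
    have := hg h
    subst this
    simp_all
  rcases lt_or_gt_of_ne hij with h | h
  · simp [h, h.le]
  · simp [h, h.le]

/-- The labeling made of `a` ones followed by the palindrome of length `2 * m` with
`n = a + 2 * m` whose first half has its zeros at the positions in `S`. -/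
def palindromicLabeling (n a : ℕ) (S : Finset ℕ) (k : Fin n) : Bool :=
  !decide (a ≤ (k : ℕ) ∧ min ((k : ℕ) - a) (n - 1 - k) ∈ S)

theorem palindromicLabeling_eq_false_iff {n a : ℕ} {S : Finset ℕ} {k : Fin n} :
    palindromicLabeling n a S k = false ↔ a ≤ (k : ℕ) ∧ min ((k : ℕ) - a) (n - 1 - k) ∈ S := by
  simp [palindromicLabeling]

theorem palindromicLabeling_injOn {n a m : ℕ} (hn : a + 2 * m = n) {S T : Finset ℕ}
    (hS : S ⊆ Finset.range m) (hT : T ⊆ Finset.range m)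
    (h : palindromicLabeling n a S = palindromicLabeling n a T) : S = T := by
  have key : ∀ {U : Finset ℕ} {s : ℕ} (hs : s < m),
      palindromicLabeling n a U ⟨a + s, by omega⟩ = false ↔ s ∈ U := by
    intro U s hs
    rw [palindromicLabeling_eq_false_iff]
    have : min (a + s - a) (n - 1 - (a + s)) = s := by omega
    simp only [this, Nat.le_add_right, true_and]
  ext s
  by_cases hs : s < m
  · rw [← key hs, ← key hs, h]
  · exact iff_of_false (fun h' => hs (Finset.mem_range.mp (hS h')))
      (fun h' => hs (Finset.mem_range.mp (hT h')))

theorem card_palindromicLabeling_false {n a m : ℕ} (hn : a + 2 * m = n) {S : Finset ℕ}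
    (hS : S ⊆ Finset.range m) :
    (Finset.univ.filter fun k => palindromicLabeling n a S k = false).card = 2 * S.card := by
  have hlt : ∀ s ∈ S, s < m := fun s hs => Finset.mem_range.mp (hS hs)
  rw [← Finset.card_filter_add_card_filter_not (fun k : Fin n => (k : ℕ) < a + m), two_mul]
  congr 1
  · refine Finset.card_bij' (fun k _ => (k : ℕ) - a)
      (fun s hs => ⟨a + s, by have := hlt s hs; omega⟩) ?_ ?_ ?_ ?_
    · intro k hk
      simp only [Finset.mem_filter, Finset.mem_univ, true_and,
        palindromicLabeling_eq_false_iff] at hk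
      have : min ((k : ℕ) - a) (n - 1 - k) = (k : ℕ) - a := by omega
      rw [this] at hk
      exact hk.1.2
    · intro s hs
      have := hlt s hs
      simp only [Finset.mem_filter, Finset.mem_univ, true_and,
        palindromicLabeling_eq_false_iff]
      have h : min (a + s - a) (n - 1 - (a + s)) = s := by omega
      exact ⟨⟨by omega, by rwa [h]⟩, by omega⟩
    · intro k hk
      simp only [Finset.mem_filter, Finset.mem_univ, true_and,
        palindromicLabeling_eq_false_iff] at hk
      ext
      simp only
      omega
    · intro s hs
      simp
  · refine Finset.card_bij' (fun k _ => n - 1 - (k : ℕ))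
      (fun s hs => ⟨n - 1 - s, by have := hlt s hs; omega⟩) ?_ ?_ ?_ ?_
    · intro k hk
      simp only [Finset.mem_filter, Finset.mem_univ, true_and,
        palindromicLabeling_eq_false_iff] at hk
      have : min ((k : ℕ) - a) (n - 1 - k) = n - 1 - k := by omega
      rw [this] at hk
      exact hk.1.2
    · intro s hs
      have := hlt s hs
      simp only [Finset.mem_filter, Finset.mem_univ, true_and,
        palindromicLabeling_eq_false_iff]
      have h : min (n - 1 - s - a) (n - 1 - (n - 1 - s)) = s := by omega
      exact ⟨⟨by omega, by rwa [h]⟩, by omega⟩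
    · intro k hk
      have := k.2
      ext
      simp only
      omega
    · intro s hs
      have := hlt s hs
      simp only
      omega

theorem card_palindromicLabeling_true {n a m : ℕ} (hn : a + 2 * m = n) {S : Finset ℕ}
    (hS : S ⊆ Finset.range m) :
    (Finset.univ.filter fun k => palindromicLabeling n a S k = true).card + 2 * S.card = n := by
  have h := Finset.card_filter_add_card_filter_not (s := Finset.univ)
    (fun k => palindromicLabeling n a S k = true)
  simp only [Bool.not_eq_true, card_palindromicLabeling_false hn hS, Finset.card_univ,
    Fintype.card_fin] at h
  exact h

theorem card_palindromicLabeling_true_block {n a m : ℕ} (hn : a + 2 * m = n) {S : Finset ℕ}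
    (hS : S ⊆ Finset.range m) :
    (Finset.univ.filter fun k : Fin n => palindromicLabeling n a S k = true ∧ a ≤ (k : ℕ)).card +
      2 * S.card = 2 * m := by
  have h := Finset.card_filter_add_card_filter_not
    (s := Finset.univ.filter fun k => palindromicLabeling n a S k = true)
    (fun k : Fin n => a ≤ (k : ℕ))
  have h' := card_palindromicLabeling_true hn hS
  have hpre : ((Finset.univ.filter fun k => palindromicLabeling n a S k = true).filter
      fun k : Fin n => ¬ a ≤ (k : ℕ)).card = a := by
    rw [← Finset.card_range a]
    refine Finset.card_bij' (fun k _ => (k : ℕ))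
      (fun s hs => ⟨s, by have := Finset.mem_range.mp hs; omega⟩) ?_ ?_ ?_ ?_
    · intro k hk
      simp_all
    · intro s hs
      have := Finset.mem_range.mp hs
      simp [palindromicLabeling, this]
    · intro k hk
      rfl
    · intro s hs
      rfl
  rw [hpre, Finset.filter_filter] at h
  omega

/-- By reflection, half of the zero-one pairs inside the palindromic block are correctly
ordered. -/
theorem two_mul_card_palindromicLabeling_pairs {n a m : ℕ} (hn : a + 2 * m = n) {S : Finset ℕ}
    (hS : S ⊆ Finset.range m) :
    2 * (((Finset.univ.filter fun k => palindromicLabeling n a S k = false) ×ˢ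
      (Finset.univ.filter fun k => palindromicLabeling n a S k = true)).filter
        fun x => x.1 < x.2).card = 2 * S.card * (2 * m - 2 * S.card) := by
  set Z := Finset.univ.filter fun k => palindromicLabeling n a S k = false with hZ
  set O := Finset.univ.filter fun k : Fin n =>
    palindromicLabeling n a S k = true ∧ a ≤ (k : ℕ) with hO
  have hblock : ((Z ×ˢ (Finset.univ.filter fun k => palindromicLabeling n a S k = true)).filter
      fun x => x.1 < x.2) = (Z ×ˢ O).filter fun x => x.1 < x.2 := by
    ext ⟨i, j⟩
    simp only [hZ, hO, Finset.mem_filter, Finset.mem_product, Finset.mem_univ, true_and,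
      palindromicLabeling_eq_false_iff, Fin.lt_def]
    constructor
    · rintro ⟨⟨h1, h2⟩, h3⟩
      exact ⟨⟨h1, h2, by omega⟩, h3⟩
    · rintro ⟨⟨h1, h2, _⟩, h3⟩
      exact ⟨⟨h1, h2⟩, h3⟩
  have hsplit := Finset.card_filter_add_card_filter_not (s := Z ×ˢ O) (fun x => x.1 < x.2)
  have hrefl : ∀ k : Fin n, a ≤ (k : ℕ) → ∀ h : a + (n - 1 - k) < n,
      palindromicLabeling n a S ⟨a + (n - 1 - k), h⟩ = palindromicLabeling n a S k := by
    intro k hk h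
    have hk2 := k.2
    have : min (a + (n - 1 - (k : ℕ)) - a) (n - 1 - (a + (n - 1 - k))) =
        min ((k : ℕ) - a) (n - 1 - k) := by omega
    simp only [palindromicLabeling, this, hk]
    simp
  have hswap : ((Z ×ˢ O).filter fun x => x.1 < x.2).card =
      ((Z ×ˢ O).filter fun x => ¬ x.1 < x.2).card := by
    have hZa : ∀ x ∈ Z ×ˢ O, a ≤ (x.1 : ℕ) ∧ a ≤ (x.2 : ℕ) := by
      intro x hx
      simp only [hZ, hO, Finset.mem_filter, Finset.mem_product, Finset.mem_univ, true_and,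
        palindromicLabeling_eq_false_iff] at hx
      exact ⟨hx.1.1, hx.2.2⟩
    have hmem : ∀ x ∈ Z ×ˢ O, ∀ h1 h2,
        ((⟨a + (n - 1 - x.1), h1⟩, ⟨a + (n - 1 - x.2), h2⟩) : Fin n × Fin n) ∈ Z ×ˢ O := by
      intro x hx h1 h2
      have ha := hZa x hx
      simp only [hZ, hO, Finset.mem_filter, Finset.mem_product, Finset.mem_univ, true_and] at hx ⊢
      rw [hrefl _ ha.1, hrefl _ ha.2]
      exact ⟨hx.1, hx.2.1, by omega⟩
    have hne : ∀ x ∈ Z ×ˢ O, (x.1 : ℕ) ≠ x.2 := by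
      intro x hx h
      have h := Fin.ext h
      simp only [hZ, hO, Finset.mem_filter, Finset.mem_product, Finset.mem_univ, true_and] at hx
      rw [h] at hx
      exact Bool.false_ne_true (hx.1.symm.trans hx.2.1)
    have hb : ∀ x ∈ Z ×ˢ O, a + (n - 1 - (x.1 : ℕ)) < n ∧ a + (n - 1 - (x.2 : ℕ)) < n := by
      intro x hx
      have := hZa x hx
      omega
    refine Finset.card_bij'
      (fun x hx => (⟨a + (n - 1 - x.1), (hb x (Finset.mem_filter.mp hx).1).1⟩,
        ⟨a + (n - 1 - x.2), (hb x (Finset.mem_filter.mp hx).1).2⟩))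
      (fun x hx => (⟨a + (n - 1 - x.1), (hb x (Finset.mem_filter.mp hx).1).1⟩,
        ⟨a + (n - 1 - x.2), (hb x (Finset.mem_filter.mp hx).1).2⟩)) ?_ ?_ ?_ ?_
    · intro x hx
      have hx := Finset.mem_filter.mp hx
      refine Finset.mem_filter.mpr ⟨hmem x hx.1 _ _, ?_⟩
      have := hZa x hx.1
      have := hx.2
      simp only [Fin.lt_def] at this ⊢
      omega
    · intro x hx
      have hx := Finset.mem_filter.mp hx
      refine Finset.mem_filter.mpr ⟨hmem x hx.1 _ _, ?_⟩
      have := hZa x hx.1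
      have := hne x hx.1
      have := hx.2
      simp only [Fin.lt_def] at this ⊢
      omega
    all_goals
      intro x hx
      have := hZa x (Finset.mem_filter.mp hx).1
      ext <;> simp only <;> omega
  have hOc := card_palindromicLabeling_true_block hn hS
  rw [← hO] at hOc
  have hOc' : O.card = 2 * m - 2 * S.card := by omega
  rw [Finset.card_product, hOc', hZ, card_palindromicLabeling_false hn hS, ← hZ] at hsplit
  rw [hblock, ← hsplit]
  omega

theorem auc_palindromicLabeling {p q : ℕ} (hq : 0 < q) (hpq : 2 * p ≤ q) {S : Finset ℕ}
    (hS : S ⊆ Finset.range (q + 2 * p)) (hc : S.card = q)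
    {g : Fin (4 * q) → ℝ} (hg : StrictMono g) :
    auc (palindromicLabeling (4 * q) (2 * q - 4 * p) S) g = (p : ℝ) / q := by
  have hn : 2 * q - 4 * p + 2 * (q + 2 * p) = 4 * q := by omega
  have h0 := card_palindromicLabeling_false hn hS
  have h1 := card_palindromicLabeling_true hn hS
  have h2 := two_mul_card_palindromicLabeling_pairs hn hS
  have h1' : (Finset.univ.filter fun k =>
      palindromicLabeling (4 * q) (2 * q - 4 * p) S k = true).card = 2 * q := by omega
  have h3 : 2 * (q + 2 * p) - 2 * S.card = 4 * p := by omega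
  rw [h3, hc] at h2
  unfold auc
  rw [← Finset.sum_product', Finset.sum_boole, h0, h1', hc]
  simp only [hg.lt_iff_lt]
  have h2' := congrArg (Nat.cast : ℕ → ℝ) h2
  push_cast at h2' ⊢
  have hq' : (0 : ℝ) < q := by exact_mod_cast hq
  rw [div_eq_div_iff (by positivity) (by positivity)]
  linear_combination (q : ℝ) / 2 * h2'

theorem choose_le_card_labelings {p q : ℕ} (hq : 0 < q) (hpq : 2 * p ≤ q)
    {g : Fin (4 * q) → ℝ} (hg : Function.Injective g) :
    (q + 2 * p).choose q ≤ Nat.card {y : Fin (4 * q) → Bool //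
      (∃ i, y i = false) ∧ (∃ i, y i = true) ∧ auc y g = (p : ℝ) / (q : ℝ)} := by
  have hn : 2 * q - 4 * p + 2 * (q + 2 * p) = 4 * q := by omega
  let e := Tuple.sort g
  have hmono : StrictMono (g ∘ e) :=
    (Tuple.monotone_sort g).strictMono_of_injective (hg.comp e.injective)
  have hcard : (q + 2 * p).choose q =
      Nat.card {S // S ∈ Finset.powersetCard q (Finset.range (q + 2 * p))} := by
    rw [Nat.card_eq_fintype_card, Fintype.card_coe, Finset.card_powersetCard, Finset.card_range]
  rw [hcard]
  refine Nat.card_le_card_of_injective (fun S =>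
    ⟨palindromicLabeling (4 * q) (2 * q - 4 * p) S.1 ∘ e.symm, ?_, ?_, ?_⟩) ?_
  · have hS := Finset.mem_powersetCard.mp S.2
    have h := card_palindromicLabeling_false hn hS.1
    obtain ⟨i, hi⟩ := Finset.card_pos.mp (by rw [h, hS.2]; omega)
    exact ⟨e i, by simpa using hi⟩
  · have hS := Finset.mem_powersetCard.mp S.2
    have h := card_palindromicLabeling_true hn hS.1
    obtain ⟨i, hi⟩ := Finset.card_pos.mp (show 0 < (Finset.univ.filter fun k =>
      palindromicLabeling (4 * q) (2 * q - 4 * p) S.1 k = true).card by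
        have := hS.2
        omega)
    exact ⟨e i, by simpa using hi⟩
  · have hS := Finset.mem_powersetCard.mp S.2
    rw [← auc_palindromicLabeling hq hpq hS.1 hS.2 hmono, ← auc_comp_equiv e]
    congr 1
    ext i
    simp
  · intro S T h
    have hS := Finset.mem_powersetCard.mp S.2
    have hT := Finset.mem_powersetCard.mp T.2
    have h' : palindromicLabeling (4 * q) (2 * q - 4 * p) S.1 =
        palindromicLabeling (4 * q) (2 * q - 4 * p) T.1 :=
      e.symm.surjective.injective_comp_right (Subtype.ext_iff.mp h)
    exact Subtype.ext (palindromicLabeling_injOn hn hS.1 hT.1 h')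

theorem one_add_two_mul_pow_le_card_labelings {p q : ℕ} (hq : 0 < q) (hpq : 2 * p ≤ q)
    {g : Fin (4 * q) → ℝ} (hg : Function.Injective g) :
    (1 + 2 * ((p : ℝ) / q)) ^ q ≤ (Nat.card {y : Fin (4 * q) → Bool //
      (∃ i, y i = false) ∧ (∃ i, y i = true) ∧ auc y g = (p : ℝ) / (q : ℝ)} : ℝ) := by
  have hq' : (0 : ℝ) < q := by exact_mod_cast hq
  have h : 1 + 2 * ((p : ℝ) / q) = ((q + 2 * p : ℕ) : ℝ) / q := by
    push_cast
    field_simp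
  rw [h]
  exact (div_pow_le_choose (by omega)).trans
    (by exact_mod_cast choose_le_card_labelings hq hpq hg)

/-- For any target AUC `c = p/q ∈ (0,1)` and any injective guesses on `n = 4q` examples,
the number of binary labelings (with both classes nonempty) achieving AUC exactly `c`
is at least `(2 - 2|c - 1/2|)^(n/4) = (2 - 2|p/q - 1/2|)^q`. -/
theorem stmt5 (p q : ℕ) (hp : 0 < p) (hpq : p < q)
    (g : Fin (4 * q) → ℝ) (hg : Function.Injective g) :
    ((2 : ℝ) - 2 * |(p : ℝ) / (q : ℝ) - 1 / 2|) ^ q ≤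
      (Nat.card {y : Fin (4 * q) → Bool //
        (∃ i, y i = false) ∧ (∃ i, y i = true) ∧ auc y g = (p : ℝ) / (q : ℝ)} : ℝ) := by
  have hq : 0 < q := by omega
  have hq' : (0 : ℝ) < q := by exact_mod_cast hq
  rcases le_total (2 * p) q with h | h
  · have hc : (p : ℝ) / q ≤ 1 / 2 := by
      rw [div_le_div_iff₀ hq' two_pos]
      have : (2 : ℝ) * p ≤ q := by exact_mod_cast h
      linarith
    rw [abs_of_nonpos (by linarith)]
    convert one_add_two_mul_pow_le_card_labelings hq h hg using 2
    ring
  · have hc : 1 / 2 ≤ (p : ℝ) / q := by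
      rw [div_le_div_iff₀ two_pos hq']
      have : (q : ℝ) ≤ 2 * p := by exact_mod_cast h
      linarith
    have hr : ((q - p : ℕ) : ℝ) / q = 1 - (p : ℝ) / q := by
      rw [Nat.cast_sub hpq.le, sub_div, div_self hq'.ne']
    have hset : ∀ y : Fin (4 * q) → Bool,
        ((∃ i, y i = false) ∧ (∃ i, y i = true) ∧
          auc y (fun i => -g i) = ((q - p : ℕ) : ℝ) / (q : ℝ)) ↔
        ((∃ i, y i = false) ∧ (∃ i, y i = true) ∧ auc y g = (p : ℝ) / (q : ℝ)) := by
      refine fun y => and_congr_right fun h0 => and_congr_right fun h1 => ?_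
      rw [auc_neg y g hg h0 h1, hr, sub_right_inj]
    have key := one_add_two_mul_pow_le_card_labelings (p := q - p) hq (by omega)
      (g := fun i => -g i) (neg_injective.comp hg)
    rw [Nat.card_congr (Equiv.subtypeEquivRight hset), hr] at key
    rw [abs_of_nonneg (by linarith)]
    convert key using 2
    ring
end

section
/- Let p, q be positive integers with q ≤ 2p and p < q (so 1/2 ≤ p/q < 1), let n = 4q, and let ŷ_1,…,ŷ_n be any pairwise-distinct real-valued guesses. Then the number of distinct binary labelings (y_1,…,y_n) ∈ {0,1}^n for which f(y_{1:n}, ŷ_{1:n}) = p/q is at least ((3q − 2p)/q)^q = (3 − 2p/q)^{n/4}. -/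
open Finset

theorem div_pow_le_choose_s6 (m k : ℕ) (h : k ≤ m) : ((m : ℝ) / k) ^ k ≤ (m.choose k : ℝ) := by
  induction k generalizing m with
  | zero => simp
  | succ k ih =>
    obtain ⟨m, rfl⟩ : ∃ l, m = l + 1 := ⟨m - 1, by omega⟩
    have hkm : k ≤ m := by omega
    have hkm' : (k : ℝ) ≤ m := by exact_mod_cast hkm
    have hc : ((m + 1).choose (k + 1) : ℝ) = ((m + 1 : ℕ) : ℝ) / (k + 1 : ℕ) * m.choose k := by
      have := Nat.add_one_mul_choose_eq m k
      have h2 : ((m : ℝ) + 1) * m.choose k = (m + 1).choose (k + 1) * (k + 1) := by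
        exact_mod_cast this
      push_cast
      field_simp
      linarith
    rw [hc, pow_succ']
    gcongr
    refine le_trans ?_ (ih m hkm)
    rcases Nat.eq_zero_or_pos k with rfl | hk
    · simp
    · have hk' : (0 : ℝ) < k := by exact_mod_cast hk
      gcongr ?_ ^ k
      push_cast
      rw [div_le_div_iff₀ (by positivity) hk']
      linarith

/-- For palindromic weights with disjoint supports, exactly half of the total weight of the pairs
lies on increasing pairs. -/
theorem two_mul_sum_lt_of_palindrome (N : ℕ) (a b : ℕ → ℝ)
    (ha : ∀ r < N, a (N - 1 - r) = a r) (hb : ∀ r < N, b (N - 1 - r) = b r)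
    (hab : ∀ r < N, a r * b r = 0) :
    2 * ∑ i ∈ range N, ∑ j ∈ range N, (if i < j then a i * b j else 0) =
      (∑ i ∈ range N, a i) * ∑ j ∈ range N, b j := by
  have hrev : ∑ i ∈ range N, ∑ j ∈ range N, (if i < j then a i * b j else 0) =
      ∑ i ∈ range N, ∑ j ∈ range N, (if j < i then a i * b j else 0) := by
    rw [← sum_range_reflect]
    refine sum_congr rfl fun i hi => ?_
    rw [← sum_range_reflect]
    refine sum_congr rfl fun j hj => ?_
    rw [mem_range] at hi hj
    rw [ha i hi, hb j hj]
    exact if_congr (by omega) rfl rfl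
  rw [two_mul]
  nth_rewrite 2 [hrev]
  rw [sum_mul_sum, ← sum_add_distrib]
  refine sum_congr rfl fun i hi => ?_
  rw [← sum_add_distrib]
  refine sum_congr rfl fun j _ => ?_
  rcases lt_trichotomy i j with h | rfl | h
  · simp [h, h.not_gt]
  · simp [hab i (mem_range.1 hi)]
  · simp [h, h.not_gt]

/-- The labeling of ranks consisting of `L` zeros, a word of length `m` with ones exactly on `S`,
and the mirror image of that word. -/
def mirrorLabel (L m : ℕ) (S : Finset ℕ) (r : ℕ) : Bool :=
  if r < L then false else if r - L < m then decide (r - L ∈ S) else decide (2 * m - 1 - (r - L) ∈ S)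

theorem mirrorLabel_of_lt {L m r : ℕ} {S : Finset ℕ} (h : r < L) :
    mirrorLabel L m S r = false := by
  simp [mirrorLabel, h]

theorem mirrorLabel_add_of_lt {L m r : ℕ} {S : Finset ℕ} (h : r < m) :
    mirrorLabel L m S (L + r) = decide (r ∈ S) := by
  simp [mirrorLabel, h]

theorem mirrorLabel_reflect {L m r : ℕ} {S : Finset ℕ} (h : r < 2 * m) :
    mirrorLabel L m S (L + (2 * m - 1 - r)) = mirrorLabel L m S (L + r) := by
  unfold mirrorLabel
  rcases lt_or_ge r m with h1 | h1
  · have h2 : ¬ (2 * m - 1 - r < m) := by omega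
    have h3 : 2 * m - 1 - (2 * m - 1 - r) = r := by omega
    simp [h1, h2, h3]
  · have h2 : 2 * m - 1 - r < m := by omega
    simp [h1.not_gt, h2]

theorem sum_mirrorLabel_true {L m : ℕ} {S : Finset ℕ} (hS : S ⊆ range m) :
    ∑ r ∈ range (2 * m), (if mirrorLabel L m S (L + r) = true then (1 : ℝ) else 0) = 2 * #S := by
  have h1 : ∑ r ∈ range m, (if mirrorLabel L m S (L + r) = true then (1 : ℝ) else 0) = #S := by
    rw [sum_congr rfl fun r hr => by rw [mirrorLabel_add_of_lt (mem_range.1 hr)]]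
    simp [inter_eq_right.2 hS]
  have h2 : ∑ r ∈ range m, (if mirrorLabel L m S (L + (m + r)) = true then (1 : ℝ) else 0) = #S := by
    rw [← h1, ← sum_range_reflect]
    refine sum_congr rfl fun r hr => ?_
    rw [mem_range] at hr
    rw [← mirrorLabel_reflect (r := r) (by omega)]
    congr 4
    omega
  rw [two_mul m, sum_range_add, h1, h2, two_mul]

theorem sum_mirrorLabel_false {L m : ℕ} {S : Finset ℕ} (hS : S ⊆ range m) :
    ∑ r ∈ range (2 * m), (if mirrorLabel L m S (L + r) = false then (1 : ℝ) else 0) =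
      2 * m - 2 * #S := by
  rw [← sum_mirrorLabel_true (L := L) hS, eq_sub_iff_add_eq, ← sum_add_distrib]
  rw [sum_congr rfl (g := fun _ => (1 : ℝ)) fun r _ => by
    cases mirrorLabel L m S (L + r) <;> simp]
  simp

theorem sum_range_mirrorLabel_true {L m : ℕ} {S : Finset ℕ} (hS : S ⊆ range m) :
    ∑ r ∈ range (L + 2 * m), (if mirrorLabel L m S r = true then (1 : ℝ) else 0) = 2 * #S := by
  rw [sum_range_add, sum_mirrorLabel_true hS,
    sum_eq_zero fun r hr => by simp [mirrorLabel_of_lt (mem_range.1 hr)], zero_add]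

theorem sum_range_mirrorLabel_false {L m : ℕ} {S : Finset ℕ} (hS : S ⊆ range m) :
    ∑ r ∈ range (L + 2 * m), (if mirrorLabel L m S r = false then (1 : ℝ) else 0) =
      L + 2 * m - 2 * #S := by
  rw [sum_range_add, sum_mirrorLabel_false hS,
    sum_congr rfl (g := fun _ => (1 : ℝ)) fun r hr => by simp [mirrorLabel_of_lt (mem_range.1 hr)]]
  simp
  ring

theorem sum_pairs_mirrorLabel {L m : ℕ} {S : Finset ℕ} (hS : S ⊆ range m) :
    ∑ i ∈ range (L + 2 * m), ∑ j ∈ range (L + 2 * m),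
      (if i < j then (if mirrorLabel L m S i = false then (1 : ℝ) else 0) *
        (if mirrorLabel L m S j = true then (1 : ℝ) else 0) else 0) =
      L * (2 * #S) + (2 * m - 2 * #S) * #S := by
  rw [sum_range_add]
  congr 1
  · rw [sum_congr rfl (g := fun _ => (2 * #S : ℝ)) fun i hi => ?_]
    · simp
    · rw [mem_range] at hi
      rw [← sum_range_mirrorLabel_true (L := L) hS]
      refine sum_congr rfl fun j _ => ?_
      rcases lt_or_ge j L with hj | hj
      · simp [mirrorLabel_of_lt hj]
      · simp [mirrorLabel_of_lt hi, hi.trans_le hj]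
  · have key := two_mul_sum_lt_of_palindrome (2 * m)
      (fun r => if mirrorLabel L m S (L + r) = false then (1 : ℝ) else 0)
      (fun r => if mirrorLabel L m S (L + r) = true then (1 : ℝ) else 0)
      (fun r hr => by simp only [mirrorLabel_reflect hr])
      (fun r hr => by simp only [mirrorLabel_reflect hr])
      (fun r _ => by cases mirrorLabel L m S (L + r) <;> simp)
    simp only [sum_mirrorLabel_true hS, sum_mirrorLabel_false hS] at key
    have : ∀ i, ∑ j ∈ range (L + 2 * m),
        (if L + i < j then (if mirrorLabel L m S (L + i) = false then (1 : ℝ) else 0) *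
          (if mirrorLabel L m S j = true then (1 : ℝ) else 0) else 0) =
        ∑ j ∈ range (2 * m),
        (if i < j then (if mirrorLabel L m S (L + i) = false then (1 : ℝ) else 0) *
          (if mirrorLabel L m S (L + j) = true then (1 : ℝ) else 0) else 0) := fun i => by
      rw [sum_range_add, sum_eq_zero fun j hj => by simp [mirrorLabel_of_lt (mem_range.1 hj)],
        zero_add]
      simp only [Nat.add_lt_add_iff_left]
    simp only [this]
    linarith

/-- The AUC only depends on the labels listed in increasing order of the guesses. -/
theorem auc_comp_symm {n : ℕ} (w : ℕ → Bool) (g : Fin n → ℝ) (e : Fin n ≃ Fin n)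
    (he : StrictMono (g ∘ e)) :
    auc (fun i => w (e.symm i)) g =
      (∑ i ∈ range n, ∑ j ∈ range n, (if i < j then (if w i = false then (1 : ℝ) else 0) *
        (if w j = true then (1 : ℝ) else 0) else 0)) /
      ((∑ i ∈ range n, if w i = false then (1 : ℝ) else 0) *
        ∑ j ∈ range n, if w j = true then (1 : ℝ) else 0) := by
  have hlt : ∀ i j, g (e i) < g (e j) ↔ (i : ℕ) < j := fun i j => he.lt_iff_lt
  have hcard : ∀ c : Bool, (#{i | w (e.symm i) = c} : ℝ) =
      ∑ i ∈ range n, if w i = c then (1 : ℝ) else 0 := fun c => by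
    rw [← sum_boole, ← Equiv.sum_comp e, ← Fin.sum_univ_eq_sum_range]
    simp only [Equiv.symm_apply_apply]
  unfold auc
  rw [hcard, hcard]
  congr 1
  rw [sum_filter, ← Equiv.sum_comp e, ← Fin.sum_univ_eq_sum_range]
  refine sum_congr rfl fun i _ => ?_
  rw [sum_filter, ← Equiv.sum_comp e, ← Fin.sum_univ_eq_sum_range]
  simp only [Equiv.symm_apply_apply, hlt]
  split_ifs with hi
  · refine sum_congr rfl fun j _ => ?_
    split_ifs <;> simp
  · simp

/-- Case `1/2 ≤ p/q < 1`: for any injective guesses on `n = 4q` examples, the number of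
binary labelings (with both classes nonempty) achieving AUC exactly `p/q` is at least
`((3q - 2p)/q)^q = (3 - 2p/q)^(n/4)`. -/
theorem stmt6 (p q : ℕ) (hp : 0 < p) (hq2p : q ≤ 2 * p) (hpq : p < q)
    (g : Fin (4 * q) → ℝ) (hg : Function.Injective g) :
    ((3 * (q : ℝ) - 2 * (p : ℝ)) / (q : ℝ)) ^ q ≤
      (Nat.card {y : Fin (4 * q) → Bool //
        (∃ i, y i = false) ∧ (∃ i, y i = true) ∧ auc y g = (p : ℝ) / (q : ℝ)} : ℝ) := by
  obtain ⟨m, hm⟩ : ∃ m, m + 2 * p = 3 * q := ⟨3 * q - 2 * p, by omega⟩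
  obtain ⟨L, hL⟩ : ∃ L, 4 * q = L + 2 * m := ⟨4 * q - 2 * m, by omega⟩
  have hmR : (m : ℝ) = 3 * q - 2 * p := by
    have : (m : ℝ) + 2 * p = 3 * q := by exact_mod_cast hm
    linarith
  have hLR : (L : ℝ) = 4 * q - 2 * m := by
    have : 4 * (q : ℝ) = L + 2 * m := by exact_mod_cast hL
    linarith
  have hq : (0 : ℝ) < q := by exact_mod_cast hp.trans hpq
  rw [← hmR]
  refine (div_pow_le_choose_s6 m q (by omega)).trans ?_
  set e : Fin (4 * q) ≃ Fin (4 * q) := Tuple.sort g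
  have he : StrictMono (g ∘ e) :=
    (Tuple.monotone_sort g).strictMono_of_injective (hg.comp e.injective)
  have hlabel : ∀ S ∈ powersetCard q (range m),
      (∃ i, mirrorLabel L m S (e.symm i) = false) ∧ (∃ i, mirrorLabel L m S (e.symm i) = true) ∧
        auc (fun i => mirrorLabel L m S (e.symm i)) g = (p : ℝ) / q := by
    intro S hS
    obtain ⟨hSm, hSq⟩ := mem_powersetCard.1 hS
    have attained : ∀ c : Bool,
        0 < ∑ r ∈ range (L + 2 * m), (if mirrorLabel L m S r = c then (1 : ℝ) else 0) →
        ∃ i, mirrorLabel L m S (e.symm i) = c := by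
      intro c hc
      obtain ⟨r, hr, hr0⟩ := exists_ne_zero_of_sum_ne_zero hc.ne'
      rw [mem_range, ← hL] at hr
      exact ⟨e ⟨r, hr⟩, by simpa using hr0⟩
    refine ⟨attained _ ?_, attained _ ?_, ?_⟩
    · rw [sum_range_mirrorLabel_false hSm, hSq]
      linarith
    · rw [sum_range_mirrorLabel_true hSm, hSq]
      linarith
    · rw [auc_comp_symm _ g e he]
      nth_rewrite 1 2 3 4 [hL]
      rw [sum_pairs_mirrorLabel hSm, sum_range_mirrorLabel_false hSm,
        sum_range_mirrorLabel_true hSm, hSq, hLR, hmR, div_eq_div_iff (by ring_nf; positivity) hq.ne']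
      ring
  have hcard : Nat.card (powersetCard q (range m)) = m.choose q := by
    rw [Nat.card_eq_fintype_card, Fintype.card_coe, card_powersetCard, card_range]
  rw [← hcard, Nat.cast_le]
  refine Nat.card_le_card_of_injective
    (fun S => ⟨fun i => mirrorLabel L m S.1 (e.symm i), hlabel S.1 S.2⟩) ?_
  rintro ⟨S, hS⟩ ⟨T, hT⟩ hST
  have hST' := congrArg Subtype.val hST
  ext r
  have hSm := (mem_powersetCard.1 hS).1
  have hTm := (mem_powersetCard.1 hT).1
  by_cases hr : r < m
  · have := congrFun hST' (e ⟨L + r, by omega⟩)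
    simpa [mirrorLabel_add_of_lt hr] using this
  · exact ⟨fun h => absurd (mem_range.1 (hSm h)) hr, fun h => absurd (mem_range.1 (hTm h)) hr⟩
end

section
/- Let p, q be positive integers with q ≤ 2p and p < q, let n = 4q, and let ŷ_1,…,ŷ_n be strictly increasing real-valued guesses (ŷ_1 < … < ŷ_n). Let (y_1,…,y_n) ∈ {0,1}^n be any labeling such that: (i) y_i = 0 for all i ∈ {1,…,2(2p−q)}; (ii) the restriction of y to the remaining L = 2(3q−2p) indices is palindromic, i.e., y_{2(2p−q)+t} = y_{2(2p−q)+(L+1−t)} for all t ∈ {1,…,L}; and (iii) exactly 2q of these last L indices carry label 1 (so the labeling has n1 = 2q ones and n0 = 2q zeros). Then f(y_{1:n}, ŷ_{1:n}) = p/q; in particular, exactly 4pq of the 4q² positive–negative pairs are correctly classified. -/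
open Finset

/-- If a labeling of `Fin n` starts with `a` negatives and is a palindrome afterwards, then the
correctly ordered positive–negative pairs number half of `(n0 + a) * n1`. -/
theorem two_mul_card_correct_pairs_of_palindrome {n a : ℕ} (ha : a ≤ n) (y : Fin n → Bool)
    (hneg : ∀ i : Fin n, (i : ℕ) < a → y i = false)
    (hpal : ∀ i j : Fin n, (i : ℕ) + (j : ℕ) = a + n - 1 → y i = y j) :
    2 * (univ.filter fun pr : Fin n × Fin n =>
        y pr.1 = false ∧ y pr.2 = true ∧ pr.1 < pr.2).card =
      ((univ.filter fun i => y i = false).card + a) * (univ.filter fun j => y j = true).card := by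
  set Z := univ.filter fun i => y i = false
  set O := univ.filter fun j => y j = true
  set P := univ.filter fun pr : Fin n × Fin n => y pr.1 = false ∧ y pr.2 = true ∧ pr.1 < pr.2
  set Q := univ.filter fun pr : Fin n × Fin n => y pr.1 = false ∧ y pr.2 = true ∧ pr.2 < pr.1
  have hband : ∀ j : Fin n, y j = true → a ≤ (j : ℕ) := fun j hj => by
    by_contra! h
    simp [hneg j h] at hj
  have hPQ : P.card + Q.card = Z.card * O.card := by
    rw [← card_product, ← card_union_of_disjoint]
    · congr 1
      ext ⟨i, j⟩
      simp only [P, Q, Z, O, mem_union, mem_filter, mem_univ, true_and, mem_product]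
      have : y i = false → y j = true → i ≠ j := by rintro h h' rfl; simp [h] at h'
      grind
    · rw [disjoint_left]
      rintro ⟨i, j⟩
      simp only [P, Q, mem_filter, mem_univ, true_and]
      grind
  have hlow : (P.filter fun pr => (pr.1 : ℕ) < a).card = a * O.card := by
    have hcard : (univ.filter fun i : Fin n => (i : ℕ) < a).card = a := by
      simp [Fin.card_filter_val_lt, ha]
    rw [← congrArg (· * O.card) hcard, ← card_product]
    congr 1
    ext ⟨i, j⟩
    simp only [P, O, mem_filter, mem_univ, true_and, mem_product]
    constructor
    · tauto
    · rintro ⟨hi, hj⟩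
      exact ⟨⟨hneg i hi, hj, Fin.lt_def.2 (hi.trans_le (hband j hj))⟩, hi⟩
  have hrefl : (P.filter fun pr => ¬ (pr.1 : ℕ) < a).card = Q.card := by
    let σ : Fin n → Fin n := fun i =>
      if h : a ≤ (i : ℕ) then ⟨a + n - 1 - i, by omega⟩ else i
    have hval : ∀ i : Fin n, a ≤ (i : ℕ) → (σ i : ℕ) = a + n - 1 - i := fun i h => by
      simp [σ, h]
    have hge : ∀ i : Fin n, a ≤ (i : ℕ) → a ≤ (σ i : ℕ) := fun i h => by
      rw [hval i h]; omega
    have hinv : ∀ i : Fin n, a ≤ (i : ℕ) → σ (σ i) = i := fun i h => by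
      apply Fin.ext
      rw [hval _ (hge i h), hval i h]; omega
    have hlabel : ∀ i : Fin n, a ≤ (i : ℕ) → y (σ i) = y i := fun i h =>
      hpal _ _ (by rw [hval i h]; omega)
    have hanti : ∀ i j : Fin n, a ≤ (i : ℕ) → a ≤ (j : ℕ) → i < j → σ j < σ i :=
      fun i j hi hj h => by
        rw [Fin.lt_def, hval i hi, hval j hj]
        omega
    refine card_nbij' (fun pr => (σ pr.1, σ pr.2)) (fun pr => (σ pr.1, σ pr.2)) ?_ ?_ ?_ ?_
    · rintro ⟨i, j⟩ h
      simp only [P, Q, coe_filter, mem_filter, mem_univ, true_and, Set.mem_ofPred_eq, not_lt] at h ⊢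
      obtain ⟨⟨hi, hj, hlt⟩, hai⟩ := h
      have haj := hband j hj
      exact ⟨(hlabel i hai).trans hi, (hlabel j haj).trans hj, hanti i j hai haj hlt⟩
    · rintro ⟨i, j⟩ h
      simp only [P, Q, coe_filter, mem_filter, mem_univ, true_and, Set.mem_ofPred_eq, not_lt] at h ⊢
      obtain ⟨hi, hj, hlt⟩ := h
      have haj := hband j hj
      have hai : a ≤ (i : ℕ) := haj.trans hlt.le
      exact ⟨⟨(hlabel i hai).trans hi, (hlabel j haj).trans hj, hanti j i haj hai hlt⟩, hge i hai⟩
    · rintro ⟨i, j⟩ h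
      simp only [P, coe_filter, mem_filter, mem_univ, true_and, Set.mem_ofPred_eq, not_lt] at h
      exact Prod.ext (hinv i h.2) (hinv j (hband j h.1.2.1))
    · rintro ⟨i, j⟩ h
      simp only [Q, coe_filter, mem_univ, true_and, Set.mem_ofPred_eq] at h
      have haj := hband j h.2.1
      exact Prod.ext (hinv i (haj.trans h.2.2.le)) (hinv j haj)
  have hsplit := card_filter_add_card_filter_not (s := P) (fun pr => (pr.1 : ℕ) < a)
  rw [hlow, hrefl] at hsplit
  linarith

/-- The AUC is the number of correctly classified pairs divided by the number of pairs. -/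
theorem auc_eq_card_div {n : ℕ} (y : Fin n → Bool) (g : Fin n → ℝ) :
    auc y g = ((univ.filter fun pr : Fin n × Fin n =>
        y pr.1 = false ∧ y pr.2 = true ∧ g pr.1 < g pr.2).card : ℝ) /
      (((univ.filter fun i => y i = false).card : ℝ) *
        ((univ.filter fun j => y j = true).card : ℝ)) := by
  unfold auc
  congr 1
  rw [← sum_product', sum_boole]
  congr 2
  ext ⟨i, j⟩
  simp [and_assoc]

/-- Construction for `1/2 ≤ p/q < 1`: with `n = 4q` strictly increasing guesses, any
labeling whose first `2(2p-q)` entries are negative, whose remaining `L = 2(3q-2p)`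
entries form a palindrome (indices `i, j` in the right band are mirror images exactly
when `i + j = 2(2p-q) + 4q - 1`, 0-based), and which has exactly `2q` positive labels
in that right band, achieves AUC exactly `p/q`; in particular exactly `4pq` of the
`4q²` positive–negative pairs are correctly classified. -/
theorem stmt8 (p q : ℕ) (hp : 0 < p) (hq2p : q ≤ 2 * p) (hpq : p < q)
    (g : Fin (4 * q) → ℝ) (hg : StrictMono g)
    (y : Fin (4 * q) → Bool)
    (h1 : ∀ i : Fin (4 * q), (i : ℕ) < 2 * (2 * p - q) → y i = false)
    (h2 : ∀ i j : Fin (4 * q),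
      (i : ℕ) + (j : ℕ) = 2 * (2 * p - q) + 4 * q - 1 → y i = y j)
    (h3 : (Finset.univ.filter fun i : Fin (4 * q) =>
        2 * (2 * p - q) ≤ (i : ℕ) ∧ y i = true).card = 2 * q) :
    auc y g = (p : ℝ) / (q : ℝ) ∧
      (Finset.univ.filter fun pr : Fin (4 * q) × Fin (4 * q) =>
          y pr.1 = false ∧ y pr.2 = true ∧ g pr.1 < g pr.2).card = 4 * p * q := by
  have hones : (univ.filter fun j : Fin (4 * q) => y j = true).card = 2 * q := by
    rw [← h3]
    congr 1
    ext j
    simp only [mem_filter, mem_univ, true_and, iff_and_self]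
    intro hj
    by_contra! h
    simp [h1 j h] at hj
  have hzeros : (univ.filter fun i : Fin (4 * q) => y i = false).card = 2 * q := by
    have h := card_filter_add_card_filter_not (s := (univ : Finset (Fin (4 * q))))
      (fun i => y i = true)
    simp only [Bool.not_eq_true, card_univ, Fintype.card_fin] at h
    omega
  have hcount : (univ.filter fun pr : Fin (4 * q) × Fin (4 * q) =>
      y pr.1 = false ∧ y pr.2 = true ∧ g pr.1 < g pr.2).card = 4 * p * q := by
    simp only [hg.lt_iff_lt]
    have h := two_mul_card_correct_pairs_of_palindrome (by omega) y h1 h2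
    rw [hzeros, hones, show 2 * q + 2 * (2 * p - q) = 4 * p by omega] at h
    linarith
  refine ⟨?_, hcount⟩
  have hq : (q : ℝ) ≠ 0 := by exact_mod_cast (hp.trans hpq).ne'
  rw [auc_eq_card_div, hcount, hzeros, hones]
  push_cast
  field_simp
  norm_num
end
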